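/- Let G = (V, E) be a connected locally finite simple graph with symmetric positive edge weights w, let d denote the graph distance, and for each vertex v let d_v = Σ_{u ∼ v} w_{vu} and μ_v(u) = w_{vu}/d_v for u ∼ v (and μ_v(u) = 0 otherwise). Then for any pair of adjacent vertices x, y, the Ollivier–Ricci curvature satisfies κ(x, y) ≥ − (1 − w_{xy}/d_x − w_{xy}/d_y − Σ_{x₁ : x₁ ∼ x, x₁ ∼ y} max(w_{x₁x}/d_x, w_{x₁y}/d_y))₊ − (1 − w_{xy}/d_x − w_{xy}/d_y − Σ_{x₁ : x₁ ∼ x, x₁ ∼ y} min(w_{x₁x}/d_x, w_{x₁y}/d_y))₊ + Σ_{x₁ : x₁ ∼ x, x₁ ∼ y} min(w_{x₁x}/d_x, w_{x₁y}/d_y). -/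

import Mathlib

open scoped Classical

/-- Wasserstein distance between finitely supported mass functions `μ ν : X → ℝ`,
defined as the infimum of total transport cost over all finitely supported couplings. -/
noncomputable def W1 {X : Type*} (d : X → X → ℝ) (μ ν : X → ℝ) : ℝ :=
  sInf { c : ℝ | ∃ γ : (X × X) →₀ ℝ,
    (∀ p, 0 ≤ γ p) ∧
    (∀ u : X, (∑ᶠ v : X, γ (u, v)) = μ u) ∧
    (∀ v : X, (∑ᶠ u : X, γ (u, v)) = ν v) ∧
    c = ∑ᶠ p : X × X, d p.1 p.2 * γ p }

/-- `μ : X → ℝ` is a finitely supported probability mass function. -/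
def IsFinProb {X : Type*} (μ : X → ℝ) : Prop :=
  (∀ z, 0 ≤ μ z) ∧ (Function.support μ).Finite ∧ (∑ᶠ z, μ z) = 1

/-- A coupling supported on a finite square bounds the Wasserstein distance by its cost. -/
theorem W1_le_of_coupling {X : Type*} {d : X → X → ℝ} {μ ν : X → ℝ} (hd : ∀ u v, 0 ≤ d u v)
    (F : Finset X) (f : X → X → ℝ) (hf : ∀ u v, 0 ≤ f u v)
    (hleft : ∀ u v, f u v ≠ 0 → u ∈ F) (hright : ∀ u v, f u v ≠ 0 → v ∈ F)
    (hμ : ∀ u, ∑ v ∈ F, f u v = μ u) (hν : ∀ v, ∑ u ∈ F, f u v = ν v) :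
    W1 d μ ν ≤ ∑ u ∈ F, ∑ v ∈ F, d u v * f u v := by
  refine csInf_le ⟨0, ?_⟩ ?_
  · rintro c ⟨γ, hγ, -, -, rfl⟩
    exact finsum_nonneg fun p => mul_nonneg (hd _ _) (hγ p)
  · refine ⟨Finsupp.onFinset (F ×ˢ F) (fun p => f p.1 p.2) fun p hp =>
      Finset.mem_product.2 ⟨hleft _ _ hp, hright _ _ hp⟩, fun p => hf _ _, fun u => ?_,
      fun v => ?_, ?_⟩
    · rw [← hμ]
      exact finsum_eq_sum_of_support_subset _ fun v hv => hright _ _ hv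
    · rw [← hν]
      exact finsum_eq_sum_of_support_subset _ fun u hu => hleft _ _ hu
    · rw [← Finset.sum_product' (f := fun u v => d u v * f u v)]
      refine (finsum_eq_sum_of_support_subset _ fun p hp => ?_).symm
      have hp' : f p.1 p.2 ≠ 0 := right_ne_zero_of_mul hp
      exact Finset.mem_coe.2 (Finset.mem_product.2 ⟨hleft _ _ hp', hright _ _ hp'⟩)

/-- Decompose `μ` and `ν` into a common part `m` and blocks `s i`, `t j`. A transport plan `g`
between the blocks, of unit cost at most `c i j` from block `i` to block `j`, bounds the
Wasserstein distance. -/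
theorem W1_le_of_blocks {X ι κ : Type*} [Fintype ι] [Fintype κ] {d : X → X → ℝ} {μ ν : X → ℝ}
    (hd : ∀ u v, 0 ≤ d u v) (hd0 : ∀ u, d u u = 0) (F : Finset X)
    (m : X → ℝ) (s : ι → X → ℝ) (t : κ → X → ℝ) (g c : ι → κ → ℝ)
    (hm : ∀ u, 0 ≤ m u) (hs : ∀ i u, 0 ≤ s i u) (ht : ∀ j v, 0 ≤ t j v) (hg : ∀ i j, 0 ≤ g i j)
    (hmF : ∀ u, m u ≠ 0 → u ∈ F) (hsF : ∀ i u, s i u ≠ 0 → u ∈ F)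
    (htF : ∀ j v, t j v ≠ 0 → v ∈ F)
    (hgs : ∀ i, ∑ j, g i j = ∑ u ∈ F, s i u) (hgt : ∀ j, ∑ i, g i j = ∑ v ∈ F, t j v)
    (hμ : ∀ u, μ u = m u + ∑ i, s i u) (hν : ∀ v, ν v = m v + ∑ j, t j v)
    (hc : ∀ i j u v, s i u ≠ 0 → t j v ≠ 0 → d u v ≤ c i j) :
    W1 d μ ν ≤ ∑ i, ∑ j, c i j * g i j := by
  set S : ι → ℝ := fun i => ∑ u ∈ F, s i u with hS
  set T : κ → ℝ := fun j => ∑ v ∈ F, t j v with hT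
  have hS0 : ∀ i, 0 ≤ S i := fun i => Finset.sum_nonneg fun u _ => hs i u
  have hT0 : ∀ j, 0 ≤ T j := fun j => Finset.sum_nonneg fun v _ => ht j v
  have hgS : ∀ i j, S i = 0 → g i j = 0 := fun i j h =>
    (Finset.sum_eq_zero_iff_of_nonneg fun j _ => hg i j).1 ((hgs i).trans h) j (Finset.mem_univ j)
  have hgT : ∀ i j, T j = 0 → g i j = 0 := fun i j h =>
    (Finset.sum_eq_zero_iff_of_nonneg fun i _ => hg i j).1 ((hgt j).trans h) i (Finset.mem_univ i)
  have hsS : ∀ i u, S i = 0 → s i u = 0 := fun i u h => by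
    by_contra hne
    exact hne ((Finset.sum_eq_zero_iff_of_nonneg fun u _ => hs i u).1 h u (hsF i u hne))
  have htT : ∀ j v, T j = 0 → t j v = 0 := fun j v h => by
    by_contra hne
    exact hne ((Finset.sum_eq_zero_iff_of_nonneg fun v _ => ht j v).1 h v (htF j v hne))
  set k : ι → κ → X → X → ℝ := fun i j u v => g i j / (S i * T j) * (s i u * t j v) with hk
  have hk0 : ∀ i j u v, 0 ≤ k i j u v := fun i j u v =>
    mul_nonneg (div_nonneg (hg i j) (mul_nonneg (hS0 i) (hT0 j))) (mul_nonneg (hs i u) (ht j v))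
  have hkrow : ∀ i j u, ∑ v ∈ F, k i j u v = g i j / S i * s i u := fun i j u => by
    simp only [hk, ← Finset.mul_sum]
    change g i j / (S i * T j) * (s i u * T j) = _
    by_cases h : T j = 0
    · simp [hgT i j h]
    · by_cases h' : S i = 0
      · simp [h']
      · field_simp
  have hkcol : ∀ i j v, ∑ u ∈ F, k i j u v = g i j / T j * t j v := fun i j v => by
    simp only [hk, ← Finset.mul_sum, ← Finset.sum_mul]
    change g i j / (S i * T j) * (S i * t j v) = _
    by_cases h : S i = 0
    · simp [hgS i j h]
    · by_cases h' : T j = 0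
      · simp [h']
      · field_simp
  have hktot : ∀ i j, ∑ u ∈ F, ∑ v ∈ F, k i j u v = g i j := fun i j => by
    simp only [hkrow, ← Finset.mul_sum]
    change g i j / S i * S i = _
    by_cases h : S i = 0
    · simp [hgS i j h]
    · field_simp
  refine (W1_le_of_coupling hd F (fun u v => (if u = v then m u else 0) + ∑ i, ∑ j, k i j u v)
    (fun u v => ?_) (fun u v h => ?_) (fun u v h => ?_) (fun u => ?_) (fun v => ?_)).trans ?_
  · refine add_nonneg ?_ (Finset.sum_nonneg fun i _ => Finset.sum_nonneg fun j _ => hk0 i j u v)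
    split_ifs
    exacts [hm u, le_rfl]
  · by_contra hu
    have h1 : m u = 0 := by_contra fun h => hu (hmF u h)
    have h2 : ∀ i, s i u = 0 := fun i => by_contra fun h => hu (hsF i u h)
    exact h (by simp [hk, h1, h2])
  · by_contra hv
    have h1 : m v = 0 := by_contra fun h => hv (hmF v h)
    have h2 : ∀ j, t j v = 0 := fun j => by_contra fun h => hv (htF j v h)
    refine h ?_
    by_cases huv : u = v
    · subst huv
      simp [hk, h1, h2]
    · simp [hk, huv, h2]
  · rw [Finset.sum_add_distrib, hμ, Finset.sum_ite_eq, Finset.sum_comm]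
    congr 1
    · split_ifs with h
      · rfl
      · exact (by_contra fun h' => h (hmF u (Ne.symm h')))
    · refine Finset.sum_congr rfl fun i _ => ?_
      rw [Finset.sum_comm]
      simp only [hkrow, ← Finset.sum_mul, ← Finset.sum_div, hgs]
      by_cases h : S i = 0
      · simp [hsS i u h]
      · exact (congrArg (· * s i u) (div_self h)).trans (one_mul _)
  · rw [Finset.sum_add_distrib, hν, Finset.sum_ite_eq', Finset.sum_comm]
    congr 1
    · split_ifs with h
      · rfl
      · exact (by_contra fun h' => h (hmF v (Ne.symm h')))
    · simp only [Finset.sum_comm (s := F), hkcol]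
      rw [Finset.sum_comm]
      refine Finset.sum_congr rfl fun j _ => ?_
      simp only [← Finset.sum_mul, ← Finset.sum_div, hgt]
      by_cases h : T j = 0
      · simp [htT j v h]
      · exact (congrArg (· * t j v) (div_self h)).trans (one_mul _)
  · calc ∑ u ∈ F, ∑ v ∈ F, d u v * ((if u = v then m u else 0) + ∑ i, ∑ j, k i j u v)
        ≤ ∑ u ∈ F, ∑ v ∈ F, ∑ i, ∑ j, c i j * k i j u v := by
          refine Finset.sum_le_sum fun u _ => Finset.sum_le_sum fun v _ => ?_
          have h0 : d u v * (if u = v then m u else 0) = 0 := by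
            split_ifs with h
            · rw [h, hd0, zero_mul]
            · exact mul_zero _
          rw [mul_add, h0, zero_add, Finset.mul_sum]
          refine Finset.sum_le_sum fun i _ => ?_
          rw [Finset.mul_sum]
          refine Finset.sum_le_sum fun j _ => ?_
          by_cases hu : s i u = 0
          · simp [hk, hu]
          by_cases hv : t j v = 0
          · simp [hk, hv]
          exact mul_le_mul_of_nonneg_right (hc i j u v hu hv) (hk0 i j u v)
      _ = ∑ i, ∑ j, c i j * g i j := by
          simp only [← hktot, Finset.mul_sum]
          simp only [Finset.sum_comm (s := F) (t := Finset.univ)]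

/-- The north-west corner plan between two triples of masses. -/
theorem exists_northwest_plan {s t : Fin 3 → ℝ} (hs : ∀ i, 0 ≤ s i) (ht : ∀ j, 0 ≤ t j)
    (hst : s 0 + s 1 + s 2 = t 0 + t 1 + t 2) :
    ∃ g : Fin 3 → Fin 3 → ℝ, (∀ i j, 0 ≤ g i j) ∧ (∀ i, ∑ j, g i j = s i) ∧
      (∀ j, ∑ i, g i j = t j) ∧ g 0 2 = max (s 0 - t 0 - t 1) 0 ∧
      g 0 1 + g 0 2 + g 1 1 + g 1 2 = max (s 0 + s 1 - t 0) 0 := by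
  have hs0 := hs 0
  have hs1 := hs 1
  have hs2 := hs 2
  have ht0 := ht 0
  have ht1 := ht 1
  have ht2 := ht 2
  generalize ha : s 0 = a, hb : s 1 = b, hc : s 2 = c, hp : t 0 = p, hq : t 1 = q,
    hr : t 2 = r at hst hs0 hs1 hs2 ht0 ht1 ht2 ⊢
  refine ⟨![![min a p, min a (p + q) - min a p, a - min a (p + q)],
    ![min (a + b) p - min a p,
      min (a + b) (p + q) - min (a + b) p - min a (p + q) + min a p,
      b - min (a + b) (p + q) + min a (p + q)],
    ![p - min (a + b) p, q - min (a + b) (p + q) + min (a + b) p,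
      r - a - b + min (a + b) (p + q)]], ?_, ?_, ?_, ?_, ?_⟩
  · intro i j
    fin_cases i <;> fin_cases j <;> simp <;> grind
  · intro i
    fin_cases i <;> simp [Fin.sum_univ_three] <;> linarith
  · intro j
    fin_cases j <;> simp [Fin.sum_univ_three] <;> linarith
  · simp
    grind
  · simp
    grind

set_option maxHeartbeats 400000 in
/-- Lower bound on the Ollivier–Ricci curvature `κ(x,y) = 1 - W₁(μx, μy)` at adjacent
vertices of a weighted, connected, locally finite simple graph. -/
theorem graph_orc_lower_bound {V : Type*} (G : SimpleGraph V) [G.LocallyFinite]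
    (hconn : G.Connected)
    (w : V → V → ℝ) (hsymm : ∀ u v, w u v = w v u)
    (hpos : ∀ u v, G.Adj u v → 0 < w u v)
    (D : V → ℝ) (hD : ∀ v, D v = ∑ u ∈ G.neighborFinset v, w v u)
    (μ : V → V → ℝ) (hμ : ∀ v u, μ v u = if G.Adj v u then w v u / D v else 0)
    (x y : V) (hxy : G.Adj x y) :
    1 - W1 (fun u v => (G.dist u v : ℝ)) (μ x) (μ y) ≥
      - max (1 - w x y / D x - w x y / D y -
            ∑ᶠ z, if G.Adj z x ∧ G.Adj z y then max (w z x / D x) (w z y / D y) else 0) 0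
        - max (1 - w x y / D x - w x y / D y -
            ∑ᶠ z, if G.Adj z x ∧ G.Adj z y then min (w z x / D x) (w z y / D y) else 0) 0
        + ∑ᶠ z, if G.Adj z x ∧ G.Adj z y then min (w z x / D x) (w z y / D y) else 0 := by
  have hDpos : ∀ u v, G.Adj u v → 0 < D u := fun u v h => by
    rw [hD]
    exact Finset.sum_pos (fun z hz => hpos u z ((G.mem_neighborFinset u z).1 hz))
      ⟨v, (G.mem_neighborFinset u v).2 h⟩
  have hDx := hDpos x y hxy
  have hDy := hDpos y x hxy.symm
  have hμ0 : ∀ u v z, G.Adj u v → 0 ≤ μ u z := fun u v z h => by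
    rw [hμ]
    split_ifs with hz
    exacts [(div_pos (hpos _ _ hz) (hDpos _ _ h)).le, le_rfl]
  have hadj : ∀ u z, μ u z ≠ 0 → G.Adj u z := fun u z h => by
    by_contra hz
    exact h (by rw [hμ, if_neg hz])
  set F := G.neighborFinset x ∪ G.neighborFinset y with hF
  have hxF : x ∈ F := by simp [hF, hxy.symm]
  have hyF : y ∈ F := by simp [hF, hxy]
  have hmass : ∀ u v, G.Adj u v → G.neighborFinset u ⊆ F → ∑ z ∈ F, μ u z = 1 :=
    fun u v h hu => by
      rw [← Finset.sum_subset hu fun z _ hz => by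
        rw [hμ, if_neg (by simpa using hz)]]
      rw [← div_self (hDpos u v h).ne', hD u, Finset.sum_div]
      refine Finset.sum_congr rfl fun z hz => ?_
      rw [hμ, if_pos (by simpa using hz), hD u]
  have hmassx := hmass x y hxy Finset.subset_union_left
  have hmassy := hmass y x hxy.symm Finset.subset_union_right
  have hax : ∀ z, 0 ≤ μ x z := fun z => hμ0 x y z hxy
  have hby : ∀ z, 0 ≤ μ y z := fun z => hμ0 y x z hxy.symm
  have hfin : ∀ op : ℝ → ℝ → ℝ,
      (∑ᶠ z, if G.Adj z x ∧ G.Adj z y then op (w z x / D x) (w z y / D y) else 0) =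
        ∑ z ∈ F, if G.Adj z x ∧ G.Adj z y then op (μ x z) (μ y z) else 0 := fun op => by
    rw [finsum_eq_sum_of_support_subset (s := F)]
    · refine Finset.sum_congr rfl fun z _ => ?_
      split_ifs with h
      · rw [hμ, hμ, if_pos h.1.symm, if_pos h.2.symm, hsymm z x, hsymm z y]
      · rfl
    · intro z hz
      have h : G.Adj z x ∧ G.Adj z y := by
        by_contra h
        exact hz (if_neg h)
      simp [hF, h.1.symm]
  rw [hfin min, hfin max]
  have hα : w x y / D x = μ x y := by rw [hμ, if_pos hxy]
  have hβ : w x y / D y = μ y x := by rw [hμ, if_pos hxy.symm, hsymm]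
  rw [hα, hβ]
  set m : V → ℝ := fun z => if G.Adj z x ∧ G.Adj z y then min (μ x z) (μ y z) else 0 with hm
  set M : V → ℝ := fun z => if G.Adj z x ∧ G.Adj z y then max (μ x z) (μ y z) else 0 with hM
  set s : Fin 3 → V → ℝ := ![fun z => if (G.Adj z x ∧ G.Adj z y) ∨ z = y then 0 else μ x z,
    fun z => if G.Adj z x ∧ G.Adj z y then μ x z - min (μ x z) (μ y z) else 0,
    fun z => if z = y then μ x z else 0] with hs
  set t : Fin 3 → V → ℝ := ![fun z => if z = x then μ y z else 0,
    fun z => if G.Adj z x ∧ G.Adj z y then μ y z - min (μ x z) (μ y z) else 0,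
    fun z => if (G.Adj z x ∧ G.Adj z y) ∨ z = x then 0 else μ y z] with ht
  have hmF : ∀ z, m z ≠ 0 → z ∈ F := fun z hz => by
    have h : G.Adj z x ∧ G.Adj z y := by
      by_contra h
      exact hz (if_neg h)
    simp [hF, h.1.symm]
  have hm0 : ∀ z, 0 ≤ m z := fun z => by
    simp only [hm]
    split_ifs
    exacts [le_min (hax z) (hby z), le_rfl]
  have hs0 : ∀ i z, 0 ≤ s i z := fun i z => by
    have := hax z
    fin_cases i <;> simp [hs] <;> split_ifs <;> simp [this]
  have ht0 : ∀ i z, 0 ≤ t i z := fun i z => by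
    have := hby z
    fin_cases i <;> simp [ht] <;> split_ifs <;> simp [this]
  have hsx : ∀ z, μ x z = m z + ∑ i, s i z := fun z => by
    have h1 : z = y → ¬ G.Adj z y := fun h => h ▸ G.irrefl
    simp only [hm, hs, Fin.sum_univ_three, Matrix.cons_val]
    split_ifs <;> first | (exfalso; tauto) | ring
  have hty : ∀ z, μ y z = m z + ∑ i, t i z := fun z => by
    have h1 : z = x → ¬ G.Adj z x := fun h => h ▸ G.irrefl
    simp only [hm, ht, Fin.sum_univ_three, Matrix.cons_val]
    split_ifs <;> first | (exfalso; tauto) | ring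
  have hMx : ∀ z, μ x z + t 1 z = s 0 z + s 2 z + M z := fun z => by
    have h1 : z = y → ¬ G.Adj z y := fun h => h ▸ G.irrefl
    have h2 := min_add_max (μ x z) (μ y z)
    simp only [hM, hs, ht, Matrix.cons_val]
    split_ifs <;> first | (exfalso; tauto) | linarith
  have hs2sum : ∑ z ∈ F, s 2 z = μ x y := by
    simp [hs, hyF]
  have ht0sum : ∑ z ∈ F, t 0 z = μ y x := by
    simp [ht, hxF]
  have hsadj : ∀ i z, s i z ≠ 0 → G.Adj x z := fun i z h => hadj x z fun h0 => h <| by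
    have h1 := hby z
    fin_cases i <;> simp [hs, h0, h1]
  have htadj : ∀ i z, t i z ≠ 0 → G.Adj y z := fun i z h => hadj y z fun h0 => h <| by
    have h1 := hax z
    fin_cases i <;> simp [ht, h0, h1]
  have hs1y : ∀ z, s 1 z ≠ 0 → G.Adj z y := fun z h => by
    by_contra hz
    exact h (by simp [hs, hz])
  have ht1x : ∀ z, t 1 z ≠ 0 → G.Adj z x := fun z h => by
    by_contra hz
    exact h (by simp [ht, hz])
  have hs2y : ∀ z, s 2 z ≠ 0 → z = y := fun z h => by
    by_contra hz
    exact h (by simp [hs, hz])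
  have ht0x : ∀ z, t 0 z ≠ 0 → z = x := fun z h => by
    by_contra hz
    exact h (by simp [ht, hz])
  have hsumx : 1 = ∑ z ∈ F, m z + (∑ z ∈ F, s 0 z + ∑ z ∈ F, s 1 z + ∑ z ∈ F, s 2 z) := by
    rw [← hmassx, ← Finset.sum_add_distrib, ← Finset.sum_add_distrib, ← Finset.sum_add_distrib]
    exact Finset.sum_congr rfl fun z _ => by rw [hsx z, Fin.sum_univ_three]
  have hsumy : 1 = ∑ z ∈ F, m z + (∑ z ∈ F, t 0 z + ∑ z ∈ F, t 1 z + ∑ z ∈ F, t 2 z) := by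
    rw [← hmassy, ← Finset.sum_add_distrib, ← Finset.sum_add_distrib, ← Finset.sum_add_distrib]
    exact Finset.sum_congr rfl fun z _ => by rw [hty z, Fin.sum_univ_three]
  have hsumM : 1 + ∑ z ∈ F, t 1 z = ∑ z ∈ F, s 0 z + ∑ z ∈ F, s 2 z + ∑ z ∈ F, M z := by
    rw [← hmassx, ← Finset.sum_add_distrib, ← Finset.sum_add_distrib, ← Finset.sum_add_distrib]
    exact Finset.sum_congr rfl fun z _ => hMx z
  obtain ⟨g, hg, hgs, hgt, hg02, hgc⟩ := exists_northwest_plan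
    (s := fun i => ∑ z ∈ F, s i z) (t := fun j => ∑ z ∈ F, t j z)
    (fun i => Finset.sum_nonneg fun z _ => hs0 i z)
    (fun j => Finset.sum_nonneg fun z _ => ht0 j z) (by linarith)
  obtain ⟨δ, hδ⟩ : ∃ δ : V → V → ℝ, δ = fun u v => (G.dist u v : ℝ) := ⟨_, rfl⟩
  rw [← hδ]
  have htri : ∀ u v z, δ u z ≤ δ u v + δ v z := fun u v z => by
    simp only [hδ]
    exact_mod_cast hconn.dist_triangle
  have hd1 : ∀ u v, G.Adj u v → δ u v = 1 := fun u v h => by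
    simp only [hδ]
    exact_mod_cast SimpleGraph.dist_eq_one_iff_adj.2 h
  have hW := W1_le_of_blocks (d := δ) (μ := μ x) (ν := μ y)
    (fun _ _ => by simp [hδ]) (fun _ => by simp [hδ]) F m s t g
    ![![1, 2, 3], ![1, 2, 2], ![1, 1, 1]] hm0 hs0 ht0 hg hmF
    (fun i z h => by simp [hF, hsadj i z h]) (fun i z h => by simp [hF, htadj i z h])
    hgs hgt hsx hty (fun i j u v hu hv => by
      have hxu := hsadj i u hu
      have hyv := htadj j v hv
      have h1 := hd1 u x hxu.symm
      have h2 := hd1 y v hyv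
      have h3 := hd1 x y hxy
      have h4 := htri u x v
      have h5 := htri x y v
      have h6 : i = 1 → δ u y = 1 := fun hi => hd1 u y (hs1y u (hi ▸ hu))
      have h7 : j = 1 → δ x v = 1 := fun hj => hd1 x v (ht1x v (hj ▸ hv)).symm
      have h8 := htri u y v
      have h9 : i = 2 → u = y := fun hi => hs2y u (hi ▸ hu)
      have h10 : j = 0 → v = x := fun hj => ht0x v (hj ▸ hv)
      fin_cases i <;> fin_cases j <;> simp at h6 h7 h9 h10 ⊢ <;> subst_vars <;> linarith)
  have hcost : ∑ i, ∑ j, (![![1, 2, 3], ![1, 2, 2], ![1, 1, 1]] : Fin 3 → Fin 3 → ℝ) i j * g i j =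
      ∑ i, ∑ j, g i j + (g 0 1 + g 0 2 + g 1 1 + g 1 2) + g 0 2 := by
    simp only [Fin.sum_univ_three, Matrix.cons_val]
    ring
  rw [hcost, hgc, hg02, Finset.sum_congr rfl fun i _ => hgs i, Fin.sum_univ_three] at hW
  have e1 : ∑ z ∈ F, s 0 z - ∑ z ∈ F, t 0 z - ∑ z ∈ F, t 1 z =
      1 - μ x y - μ y x - ∑ z ∈ F, M z := by linarith
  have e2 : ∑ z ∈ F, s 0 z + ∑ z ∈ F, s 1 z - ∑ z ∈ F, t 0 z =
      1 - μ x y - μ y x - ∑ z ∈ F, m z := by linarith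
  rw [e1, e2] at hW
  linarith
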